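/- arXiv:2302.08745 — 2 statements merged into one kernel-verified Lean document; each statement's English description precedes it below -/
import Mathlib

section
/- Let 1 < p < ∞ and let λ ∈ ℂ with |λ| = 1. Then the range of S − λI is dense in d_p: for every c ∈ d_p and every ε > 0 there exists a ∈ d_p such that ‖Sa − λa − c‖_{d_p} < ε. -/
open scoped ENNReal NNReal BigOperators

/-- The `p`-th power sum defining the `d_p` (quasi-)norm:
`∑_{n} sup_{k ≥ n} |a_k|^p`, valued in `ℝ≥0∞`. -/
noncomputable def dpSum (p : ℝ) (a : ℕ → ℂ) : ℝ≥0∞ :=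
  ∑' n : ℕ, ⨆ k ∈ Set.Ici n, (‖a k‖₊ : ℝ≥0∞) ^ p

/-- The `d_p` norm `(∑_{n} sup_{k ≥ n} |a_k|^p)^{1/p}`, valued in `ℝ≥0∞`. -/
noncomputable def dpNorm (p : ℝ) (a : ℕ → ℂ) : ℝ≥0∞ := dpSum p a ^ (1 / p)

/-- Membership in the sequence space `d_p`. -/
def MemDp (p : ℝ) (a : ℕ → ℂ) : Prop := dpSum p a ≠ ⊤

/-- Convolution of sequences: `(a*b)_n = ∑_{j=0}^n a_j b_{n-j}`. -/
noncomputable def conv (a b : ℕ → ℂ) : ℕ → ℂ :=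
  fun n => ∑ j ∈ Finset.range (n + 1), a j * b (n - j)

/-- `b` is a multiplier of `d_p` if `a * b ∈ d_p` for every `a ∈ d_p`. -/
def IsMultiplier (p : ℝ) (b : ℕ → ℂ) : Prop :=
  ∀ a : ℕ → ℂ, MemDp p a → MemDp p (conv a b)

/-- The canonical sequence `e m` with a `1` in position `m` and `0` elsewhere. -/
def e (m : ℕ) : ℕ → ℂ := fun n => if n = m then 1 else 0

/-- The right shift `S a = (0, a₀, a₁, …)`. -/
def shift (a : ℕ → ℂ) : ℕ → ℂ := fun n => match n with
  | 0 => 0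
  | Nat.succ k => a k


theorem iSup_tail_le_iSup_max (p : ℝ) (hp : 0 < p) (c : ℕ → ℂ) (N n : ℕ) :
    (⨆ k ∈ Set.Ici n, (‖if k < N then 0 else c k‖₊ : ℝ≥0∞) ^ p) ≤
      ⨆ k ∈ Set.Ici (max n N), (‖c k‖₊ : ℝ≥0∞) ^ p := by
  refine iSup₂_le fun k hk => ?_
  split_ifs with h
  · simp [hp]
  · exact le_iSup₂_of_le k (max_le hk (not_lt.1 h)) le_rfl

theorem tendsto_dpSum_tail {p : ℝ} (hp : 0 < p) {c : ℕ → ℂ} (hc : MemDp p c) :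
    Filter.Tendsto (fun N : ℕ => dpSum p fun k => if k < N then 0 else c k)
      Filter.atTop (nhds 0) := by
  set u : ℕ → ℝ≥0∞ := fun n => ⨆ k ∈ Set.Ici n, (‖c k‖₊ : ℝ≥0∞) ^ p
  have hanti : Antitone u := fun m n hmn =>
    biSup_mono fun k (hk : n ≤ k) => hmn.trans hk
  have hu0 : Filter.Tendsto u Filter.atTop (nhds 0) :=
    ENNReal.tendsto_atTop_zero_of_tsum_ne_top hc
  have hlim : Filter.Tendsto (fun N : ℕ => ∑' n, u (max n N)) Filter.atTop (nhds 0) := by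
    simp_rw [← MeasureTheory.lintegral_count]
    have := MeasureTheory.tendsto_lintegral_of_dominated_convergence
      (μ := MeasureTheory.Measure.count) (F := fun N n : ℕ => u (max n N)) (f := fun _ => 0) u
      (fun _ => measurable_from_top)
      (fun N => Filter.Eventually.of_forall fun n => hanti (le_max_left n N))
      (by rw [MeasureTheory.lintegral_count]; exact hc)
      (Filter.Eventually.of_forall fun n =>
        hu0.comp (Filter.tendsto_atTop_mono (fun N => le_max_right n N) Filter.tendsto_id))
    simpa using this
  exact tendsto_of_tendsto_of_tendsto_of_le_of_le tendsto_const_nhds hlim (fun _ => zero_le)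
    fun N => ENNReal.tsum_le_tsum fun n => iSup_tail_le_iSup_max p hp c N n

theorem dpSum_le_of_bounded_support {p : ℝ} (hp : 0 < p) {x : ℕ → ℂ} {K : ℝ} {Q : ℕ}
    (hK : ∀ n, ‖x n‖ ≤ K) (hx : ∀ n, Q ≤ n → x n = 0) :
    dpSum p x ≤ Q * ENNReal.ofReal K ^ p := by
  unfold dpSum
  rw [tsum_eq_sum (s := Finset.range Q)]
  · refine (Finset.sum_le_card_nsmul _ _ (ENNReal.ofReal K ^ p) fun n _ => ?_).trans (by simp)
    refine iSup₂_le fun k _ => ENNReal.rpow_le_rpow ?_ hp.le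
    rw [← enorm_eq_nnnorm, ← ofReal_norm]
    exact ENNReal.ofReal_le_ofReal (hK k)
  · intro n hn
    simp only [ENNReal.iSup_eq_zero]
    intro k hk
    rw [hx k ((not_lt.1 (by simpa using hn)).trans hk)]
    simp [hp]

theorem dpSum_add_le {p : ℝ} (hp : 1 ≤ p) (x y : ℕ → ℂ) :
    dpSum p (fun n => x n + y n) ≤ 2 ^ (p - 1) * (dpSum p x + dpSum p y) := by
  unfold dpSum
  rw [← ENNReal.tsum_add, ← ENNReal.tsum_mul_left]
  refine ENNReal.tsum_le_tsum fun n => iSup₂_le fun k hk => ?_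
  calc (‖x k + y k‖₊ : ℝ≥0∞) ^ p ≤ ((‖x k‖₊ : ℝ≥0∞) + ‖y k‖₊) ^ p :=
        ENNReal.rpow_le_rpow (by exact_mod_cast nnnorm_add_le _ _) (by linarith)
    _ ≤ 2 ^ (p - 1) * ((‖x k‖₊ : ℝ≥0∞) ^ p + (‖y k‖₊ : ℝ≥0∞) ^ p) :=
        ENNReal.rpow_add_le_mul_rpow_add_rpow _ _ hp
    _ ≤ _ := by
        gcongr
        · exact le_iSup₂_of_le (f := fun k (_ : k ∈ Set.Ici n) => (‖x k‖₊ : ℝ≥0∞) ^ p) k hk le_rfl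
        · exact le_iSup₂_of_le (f := fun k (_ : k ∈ Set.Ici n) => (‖y k‖₊ : ℝ≥0∞) ^ p) k hk le_rfl

/-- The bounded formal solution `A` of `S A - λ A = c` is cut off by the linearly decreasing
weight `max 0 (1 - n / Q)`. -/
theorem exists_shift_sub_approx_of_finite_support {lam : ℂ} (hlam : ‖lam‖ = 1) {c : ℕ → ℂ} {N : ℕ}
    (hc : ∀ n, N ≤ n → c n = 0) :
    ∃ C : ℝ, ∀ Q : ℕ, 0 < Q → N ≤ Q → ∃ a : ℕ → ℂ, (∀ n, ‖a n‖ ≤ C) ∧ (∀ n, Q ≤ n → a n = 0) ∧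
      (∀ n, ‖shift a n - lam * a n - c n‖ ≤ C / Q) ∧
      ∀ n, Q + 1 ≤ n → shift a n - lam * a n - c n = 0 := by
  have hlam0 : lam ≠ 0 := norm_ne_zero_iff.1 (by rw [hlam]; exact one_ne_zero)
  set B : ℝ := ∑ j ∈ Finset.range N, ‖c j‖
  have hB0 : 0 ≤ B := Finset.sum_nonneg fun _ _ => norm_nonneg _
  have hcB : ∀ n, ‖c n‖ ≤ B := fun n => by
    rcases lt_or_ge n N with h | h
    · exact Finset.single_le_sum (f := fun j => ‖c j‖) (fun _ _ => norm_nonneg _)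
        (Finset.mem_range.2 h)
    · simpa [hc n h] using hB0
  set A : ℕ → ℂ := fun n => -lam⁻¹ ^ (n + 1) * ∑ j ∈ Finset.range (n + 1), lam ^ j * c j with hA
  have hAB : ∀ n, ‖A n‖ ≤ B := fun n => by
    have h1 : ‖A n‖ ≤ ∑ j ∈ Finset.range (n + 1), ‖c j‖ := by
      simp only [hA, norm_mul, norm_neg, norm_pow, norm_inv, hlam, inv_one, one_pow, one_mul]
      exact (norm_sum_le _ _).trans_eq (by simp [hlam])
    refine h1.trans ?_
    rw [← Finset.sum_filter_add_sum_filter_not (Finset.range (n + 1)) (· < N),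
      Finset.sum_eq_zero (s := Finset.filter (fun j => ¬ j < N) _), add_zero]
    · refine Finset.sum_le_sum_of_subset_of_nonneg (fun j hj => ?_) fun _ _ _ => norm_nonneg _
      exact Finset.mem_range.2 (Finset.mem_filter.1 hj).2
    · intro j hj
      simp [hc j (not_lt.1 (Finset.mem_filter.1 hj).2)]
  have hA0 : lam * A 0 = -c 0 := by simp [hA, hlam0]
  have hAsucc : ∀ n, lam * A (n + 1) = A n - c (n + 1) := fun n => by
    simp only [hA]
    rw [Finset.sum_range_succ _ (n + 1), inv_pow, inv_pow]
    field_simp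
    ring
  refine ⟨(N + 1) * B, fun Q hQ hNQ => ?_⟩
  have hQ' : (0 : ℝ) < Q := by exact_mod_cast hQ
  set w : ℕ → ℝ := fun n => max 0 (1 - n / Q) with hw
  have hw0 : ∀ n, 0 ≤ w n := fun n => le_max_left _ _
  have hw1 : ∀ n, w n ≤ 1 := fun n => max_le zero_le_one (sub_le_self _ (by positivity))
  have hwQ : ∀ n, Q ≤ n → w n = 0 := fun n hn => by
    refine max_eq_left (sub_nonpos.2 ((one_le_div hQ').2 (by exact_mod_cast hn)))
  have hwN : ∀ n : ℕ, 1 - w n ≤ n / Q := fun n => by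
    linarith [le_max_right (0 : ℝ) (1 - n / Q)]
  have hwd : ∀ n, |w n - w (n + 1)| ≤ 1 / Q := fun n => by
    refine (abs_max_sub_max_le_max _ _ _ _).trans ?_
    rw [sub_self, abs_zero, max_eq_right (abs_nonneg _), abs_of_nonneg] <;> push_cast
    · exact le_of_eq (by ring)
    · have : (0 : ℝ) ≤ 1 / Q := by positivity
      linarith [add_div (n : ℝ) 1 Q]
  have herr0 : shift (fun n => w n * A n) 0 - lam * (w 0 * A 0) - c 0 = 0 := by
    have : w 0 = 1 := by simp [hw]
    simp [shift, this, hA0]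
  have herr : ∀ n, shift (fun n => w n * A n) (n + 1) - lam * (w (n + 1) * A (n + 1)) - c (n + 1) =
      ((w n - w (n + 1) : ℝ) : ℂ) * A n - ((1 - w (n + 1) : ℝ) : ℂ) * c (n + 1) := fun n => by
    simp only [shift]
    push_cast
    linear_combination (-(w (n + 1) : ℂ)) * hAsucc n
  refine ⟨fun n => w n * A n, fun n => ?_, fun n hn => by simp [hwQ n hn], fun n => ?_,
    fun n hn => ?_⟩
  · rw [norm_mul, Complex.norm_real, Real.norm_of_nonneg (hw0 n)]
    have := mul_le_mul (hw1 n) (hAB n) (norm_nonneg _) zero_le_one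
    nlinarith [mul_nonneg (Nat.cast_nonneg (α := ℝ) N) hB0]
  · cases n with
    | zero => rw [herr0, norm_zero]; positivity
    | succ n =>
      rw [herr]
      have h1 : ‖((w n - w (n + 1) : ℝ) : ℂ) * A n‖ ≤ 1 / Q * B := by
        rw [norm_mul, Complex.norm_real]
        exact mul_le_mul (hwd n) (hAB n) (norm_nonneg _) (by positivity)
      have h2 : ‖((1 - w (n + 1) : ℝ) : ℂ) * c (n + 1)‖ ≤ N / Q * B := by
        rcases lt_or_ge (n + 1) N with h | h
        · rw [norm_mul, Complex.norm_real, Real.norm_of_nonneg (sub_nonneg.2 (hw1 _))]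
          refine mul_le_mul ((hwN _).trans ?_) (hcB _) (norm_nonneg _) (by positivity)
          gcongr
        · rw [hc _ h, mul_zero, norm_zero]; positivity
      exact (norm_sub_le _ _).trans ((add_le_add h1 h2).trans_eq (by ring))
  · obtain ⟨m, rfl⟩ : ∃ m, n = m + 1 := ⟨n - 1, by omega⟩
    rw [herr, hwQ m (by omega), hwQ (m + 1) (by omega), hc (m + 1) (by omega)]
    simp

theorem tendsto_add_one_mul_ofReal_div_rpow {p : ℝ} (hp : 1 < p) (C : ℝ) :
    Filter.Tendsto (fun Q : ℕ => ((Q + 1 : ℕ) : ℝ≥0∞) * ENNReal.ofReal (C / Q) ^ p)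
      Filter.atTop (nhds 0) := by
  have hlim : Filter.Tendsto (fun Q : ℕ => ENNReal.ofReal (2 * |C| ^ p * (Q : ℝ) ^ (-(p - 1))))
      Filter.atTop (nhds 0) := by
    have := ((tendsto_rpow_neg_atTop (sub_pos.2 hp)).comp
      tendsto_natCast_atTop_atTop).const_mul (2 * |C| ^ p)
    simpa using ENNReal.tendsto_ofReal this
  refine tendsto_of_tendsto_of_tendsto_of_le_of_le' tendsto_const_nhds hlim
    (Filter.Eventually.of_forall fun _ => zero_le) ?_
  filter_upwards [Filter.eventually_ge_atTop 1] with Q hQ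
  have hQ' : (1 : ℝ) ≤ Q := by exact_mod_cast hQ
  have hQ0 : (0 : ℝ) < Q := by linarith
  calc ((Q + 1 : ℕ) : ℝ≥0∞) * ENNReal.ofReal (C / Q) ^ p
      ≤ ENNReal.ofReal (Q + 1) * ENNReal.ofReal (|C| / Q) ^ p := by
        gcongr
        · rw [← Nat.cast_add_one, ENNReal.ofReal_natCast]
        · exact le_abs_self C
    _ = ENNReal.ofReal ((Q + 1) * (|C| / Q) ^ p) := by
        rw [ENNReal.ofReal_rpow_of_nonneg (by positivity) (by linarith),
          ← ENNReal.ofReal_mul (by positivity)]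
    _ ≤ _ := by
        refine ENNReal.ofReal_le_ofReal ?_
        have h : (Q : ℝ) ^ (-(p - 1)) = Q / (Q : ℝ) ^ p := by
          rw [neg_sub, Real.rpow_sub hQ0, Real.rpow_one]
        rw [h, Real.div_rpow (abs_nonneg C) hQ0.le]
        have : (0 : ℝ) ≤ |C| ^ p / (Q : ℝ) ^ p := by positivity
        calc ((Q : ℝ) + 1) * (|C| ^ p / (Q : ℝ) ^ p) ≤ (2 * Q) * (|C| ^ p / (Q : ℝ) ^ p) :=
              mul_le_mul_of_nonneg_right (by linarith) this
          _ = _ := by ring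

/-- for `1 < p < ∞` and `|λ| = 1`, the range of `S - λI` is dense in `d_p`. -/
theorem range_shift_sub_dense (p : ℝ) (hp : 1 < p) (lam : ℂ) (hlam : ‖lam‖ = 1) :
    ∀ c : ℕ → ℂ, MemDp p c → ∀ ε : ℝ, 0 < ε →
      ∃ a : ℕ → ℂ, MemDp p a ∧
        dpNorm p (fun n : ℕ => shift a n - lam * a n - c n) < ENNReal.ofReal ε := by
  intro c hc ε hε
  have hp0 : 0 < p := by linarith
  have hδ : 0 < ENNReal.ofReal ε ^ p :=
    ENNReal.rpow_pos (ENNReal.ofReal_pos.2 hε) ENNReal.ofReal_ne_top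
  have h2 : (2 : ℝ≥0∞) ^ (p - 1) ≠ ⊤ :=
    ENNReal.rpow_ne_top_of_nonneg (by linarith) ENNReal.ofNat_ne_top
  have hη : 0 < ENNReal.ofReal ε ^ p / 2 ^ (p - 1) / 2 :=
    ENNReal.half_pos (ENNReal.div_pos hδ.ne' h2).ne'
  obtain ⟨N, hN⟩ := ((tendsto_dpSum_tail hp0 hc).eventually_lt_const hη).exists
  obtain ⟨C, hC⟩ := exists_shift_sub_approx_of_finite_support hlam
    (c := fun n => if n < N then c n else 0) (N := N) fun n hn => if_neg (not_lt.2 hn)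
  obtain ⟨Q, hQ, hQ0, hNQ⟩ :=
    (((tendsto_add_one_mul_ofReal_div_rpow hp C).eventually_lt_const hη).and
      ((Filter.eventually_gt_atTop 0).and (Filter.eventually_ge_atTop N))).exists
  obtain ⟨a, haC, haQ, herr, herrQ⟩ := hC Q hQ0 hNQ
  refine ⟨a, ((dpSum_le_of_bounded_support hp0 haC haQ).trans_lt ?_).ne, ?_⟩
  · exact ENNReal.mul_lt_top (ENNReal.natCast_lt_top Q)
      (ENNReal.rpow_lt_top_of_nonneg hp0.le ENNReal.ofReal_ne_top)
  have htail : dpSum p (fun n => -(if n < N then 0 else c n)) =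
      dpSum p fun n => if n < N then 0 else c n := by
    simp only [dpSum, nnnorm_neg]
  have hsplit : (fun n => shift a n - lam * a n - c n) = fun n =>
      (shift a n - lam * a n - (if n < N then c n else 0)) + -(if n < N then 0 else c n) := by
    funext n
    split_ifs <;> ring
  have hlt : dpSum p (fun n => shift a n - lam * a n - c n) < ENNReal.ofReal ε ^ p := by
    rw [hsplit]
    refine (dpSum_add_le hp.le _ _).trans_lt ?_
    rw [htail, mul_comm]
    refine ENNReal.mul_lt_of_lt_div ?_
    rw [← ENNReal.add_halves (ENNReal.ofReal ε ^ p / 2 ^ (p - 1))]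
    exact ENNReal.add_lt_add ((dpSum_le_of_bounded_support hp0 herr herrQ).trans_lt hQ) hN
  rw [dpNorm, one_div, ENNReal.rpow_inv_lt_iff hp0]
  exact hlt
end

section
/- Let λ ∈ ℂ with |λ| = 1. For every a ∈ d₁ the series ∑_{n=0}^∞ λⁿ · ((Sa)_n − λ a_n) converges absolutely and equals 0, and consequently ‖Sa − λa − e₀‖_{d₁} ≥ 1 for every a ∈ d₁. In particular, e₀ is not in the d₁-norm closure of the range of S − λI, so every λ on the unit circle belongs to the residual spectrum of the right shift S on d₁. -/
open scoped ENNReal NNReal BigOperators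

theorem tsum_enorm_le_dpSum_one (a : ℕ → ℂ) : ∑' n, ‖a n‖ₑ ≤ dpSum 1 a := by
  refine ENNReal.tsum_le_tsum fun n => ?_
  simp only [ENNReal.rpow_one]
  exact le_iSup₂_of_le n Set.self_mem_Ici le_rfl

theorem summable_norm_of_memDp_one {a : ℕ → ℂ} (ha : MemDp 1 a) : Summable fun n => ‖a n‖ := by
  have h : ∑' n, (‖a n‖₊ : ℝ≥0∞) ≠ ⊤ := ne_top_of_le_ne_top ha (tsum_enorm_le_dpSum_one a)
  exact NNReal.summable_coe.2 (ENNReal.tsum_coe_ne_top_iff_summable.1 h)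

/-- for `|λ| = 1` and `a ∈ d₁`, the series `∑ λⁿ ((Sa)_n - λ a_n)` converges
absolutely to `0`, whence `‖Sa - λa - e₀‖_{d₁} ≥ 1`; so `e₀` is not in the closure of the
range of `S - λI` and `λ` lies in the residual spectrum of the right shift on `d₁`. -/
theorem unit_circle_residual_spectrum_dOne (lam : ℂ) (hlam : ‖lam‖ = 1) :
    (∀ a : ℕ → ℂ, MemDp 1 a →
      (Summable fun n : ℕ => ‖lam ^ n * (shift a n - lam * a n)‖) ∧
      (∑' n : ℕ, lam ^ n * (shift a n - lam * a n)) = 0) ∧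
    ∀ a : ℕ → ℂ, MemDp 1 a →
      (1 : ℝ≥0∞) ≤ dpNorm 1 (fun n : ℕ => shift a n - lam * a n - e 0 n) := by
  have key : ∀ a : ℕ → ℂ, MemDp 1 a →
      (Summable fun n : ℕ => ‖lam ^ n * (shift a n - lam * a n)‖) ∧
        HasSum (fun n : ℕ => lam ^ n * (shift a n - lam * a n)) 0 := by
    intro a ha
    have hh : Summable fun n => ‖lam ^ (n + 1) * a n‖ := by
      simpa [hlam] using summable_norm_of_memDp_one ha
    have hg : Summable fun n => ‖lam ^ n * shift a n‖ := by
      rw [← summable_nat_add_iff 1]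
      exact hh
    have hsplit (n : ℕ) : lam ^ n * (shift a n - lam * a n) =
        lam ^ n * shift a n - lam ^ (n + 1) * a n := by
      ring
    have hgsum : HasSum (fun n => lam ^ n * shift a n) (∑' n, lam ^ (n + 1) * a n) := by
      rw [← hasSum_nat_add_iff' 1]
      simpa [shift] using hh.of_norm.hasSum
    simp only [hsplit]
    refine ⟨(hg.add hh).of_nonneg_of_le (fun _ => norm_nonneg _) fun _ => norm_sub_le _ _, ?_⟩
    simpa using hgsum.sub hh.of_norm.hasSum
  refine ⟨fun a ha => ⟨(key a ha).1, (key a ha).2.tsum_eq⟩, fun a ha => ?_⟩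
  have he : HasSum (fun n => lam ^ n * e 0 n) 1 := by
    simpa [e] using hasSum_single (f := fun n => lam ^ n * e 0 n) 0 (by simp +contextual [e])
  have hsum : ∑' n, lam ^ n * (shift a n - lam * a n - e 0 n) = -1 := by
    simpa [mul_sub] using ((key a ha).2.sub he).tsum_eq
  calc (1 : ℝ≥0∞) = ‖∑' n, lam ^ n * (shift a n - lam * a n - e 0 n)‖ₑ := by simp [hsum]
    _ ≤ ∑' n, ‖lam ^ n * (shift a n - lam * a n - e 0 n)‖ₑ := enorm_tsum_le_tsum_enorm
    _ = ∑' n, ‖shift a n - lam * a n - e 0 n‖ₑ := by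
      have hlam' : ‖lam‖ₑ = 1 := by rw [← ofReal_norm, hlam, ENNReal.ofReal_one]
      simp [enorm_mul, enorm_pow, hlam']
    _ ≤ dpSum 1 fun n => shift a n - lam * a n - e 0 n := tsum_enorm_le_dpSum_one _
    _ = dpNorm 1 fun n => shift a n - lam * a n - e 0 n := by simp [dpNorm]
end
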